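/- arXiv:2201.03146 — 2 statements merged into one kernel-verified Lean document; each statement's English description precedes it below -/
import Mathlib

section
/- Let n ∈ ℤ, let w₁ ∈ ℂ \ ℝ, and let w₂ ∈ ℂ with Im w₂ > 0. Then the integral g_n(w₁, w₂) := ∫_ℝ e^{−2πint} / ((w₁ + t)(w₂ + t)) dt converges and equals: 0 if n ≤ 0 and Im w₁ > 0; 2πi (w₂ − w₁)^{−1} e^{2πinw₁} if n ≤ 0 and Im w₁ < 0; 2πi (w₂ − w₁)^{−1} e^{2πinw₂} if n > 0 and Im w₁ < 0; 2πi (w₂ − w₁)^{−1} (e^{2πinw₂} − e^{2πinw₁}) if n > 0, Im w₁ > 0, and w₁ ≠ w₂; and −4π² n e^{2πinw₁} if n > 0 and w₁ = w₂. -/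
open MeasureTheory

open Set FourierTransform in
/-- Fourier inversion for a function defined by two continuous integrable halves glued at `0`. -/
lemma fourier_integral_eq_of_halves {f g h : ℝ → ℂ} (hf : Continuous f) (hg : Continuous g)
    (hfg : f 0 = g 0) (hfi : IntegrableOn f (Iic 0)) (hgi : IntegrableOn g (Ioi 0))
    (hh : Integrable h)
    (hinv : ∀ t : ℝ, (∫ s in Iic (0 : ℝ), Complex.exp (2 * Real.pi * Complex.I * t * s) * f s) +
      (∫ s in Ioi (0 : ℝ), Complex.exp (2 * Real.pi * Complex.I * t * s) * g s) = h t) (x : ℝ) :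
    ∫ t : ℝ, Complex.exp (-(2 * Real.pi * Complex.I * x * t)) * h t =
      if x ≤ 0 then f x else g x := by
  let G : ℝ → ℂ := fun s => if s ≤ 0 then f s else g s
  have hGc : Continuous G := by
    refine Continuous.if_le hf hg continuous_id continuous_const ?_
    rintro s rfl
    exact hfg
  have hGf : EqOn G f (Iic 0) := fun s hs => if_pos hs
  have hGg : EqOn G g (Ioi 0) := fun s hs => if_neg (not_le.2 hs)
  have hGi : Integrable G := by
    rw [← integrableOn_univ, ← Iic_union_Ioi (a := (0 : ℝ))]
    exact (hfi.congr_fun hGf.symm measurableSet_Iic).union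
      (hgi.congr_fun hGg.symm measurableSet_Ioi)
  have hinvG : 𝓕⁻ G = h := by
    ext t
    have hint : Integrable fun s : ℝ => Complex.exp (2 * Real.pi * Complex.I * t * s) * G s := by
      refine hGi.bdd_mul (c := 1) (by fun_prop) (Filter.Eventually.of_forall fun s => ?_)
      rw [show 2 * Real.pi * Complex.I * t * s = ((2 * Real.pi * t * s : ℝ) : ℂ) * Complex.I by
        push_cast; ring, Complex.norm_exp_ofReal_mul_I]
    rw [Real.fourierInv_eq', ← hinv t]
    have : ∀ s : ℝ, Complex.exp (↑(2 * Real.pi * inner ℝ s t) * Complex.I) • G s =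
        Complex.exp (2 * Real.pi * Complex.I * t * s) * G s := by
      intro s
      rw [smul_eq_mul]
      congr 2
      simp only [RCLike.inner_apply, conj_trivial]
      push_cast
      ring
    simp_rw [this]
    rw [← integral_add_compl (measurableSet_Iic (a := (0 : ℝ))) hint, compl_Iic]
    congr 1
    · exact setIntegral_congr_fun measurableSet_Iic fun s hs => by simp only [hGf hs]
    · exact setIntegral_congr_fun measurableSet_Ioi fun s hs => by simp only [hGg hs]
  have hFi : Integrable (𝓕 G) := by
    have : 𝓕 G = fun t => h (-t) := by
      ext t
      rw [← hinvG, Real.fourierInv_eq_fourier_neg, neg_neg]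
    rw [this]
    exact hh.comp_neg
  have key := congrFun (hGc.fourier_fourierInv_eq hGi hFi) x
  rw [hinvG, Real.fourier_real_eq_integral_exp_smul] at key
  rw [show (if x ≤ 0 then f x else g x) = G x from rfl, ← key]
  congr 1
  ext t
  rw [smul_eq_mul]
  congr 2
  push_cast
  ring

lemma add_ofReal_ne_zero_of_im_ne_zero {w : ℂ} (hw : w.im ≠ 0) (t : ℝ) : w + t ≠ 0 := by
  intro h
  apply hw
  simpa using congrArg Complex.im h

lemma integrable_inv_norm_add_ofReal_sq {w : ℂ} (hw : w.im ≠ 0) :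
    Integrable fun t : ℝ => (‖w + (t : ℂ)‖ ^ 2)⁻¹ := by
  have h := (((integrable_inv_one_add_sq.comp_div hw).comp_add_right w.re).const_mul
    (w.im ^ 2)⁻¹)
  refine h.congr (Filter.Eventually.of_forall fun t => ?_)
  simp only
  rw [← mul_inv, Complex.sq_norm, Complex.normSq_apply]
  congr 1
  simp only [Complex.add_re, Complex.add_im, Complex.ofReal_re, Complex.ofReal_im]
  field_simp
  ring

lemma integrable_inv_mul_add_ofReal {w₁ w₂ : ℂ} (h₁ : w₁.im ≠ 0) (h₂ : w₂.im ≠ 0) :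
    Integrable fun t : ℝ => ((w₁ + (t : ℂ)) * (w₂ + (t : ℂ)))⁻¹ := by
  refine ((integrable_inv_norm_add_ofReal_sq h₁).add
    (integrable_inv_norm_add_ofReal_sq h₂)).mono' ?_ (Filter.Eventually.of_forall fun t => ?_)
  · refine (Continuous.inv₀ (by fun_prop) fun t => ?_).aestronglyMeasurable
    exact mul_ne_zero (add_ofReal_ne_zero_of_im_ne_zero h₁ t)
      (add_ofReal_ne_zero_of_im_ne_zero h₂ t)
  · simp only [Pi.add_apply, norm_inv, norm_mul, mul_inv, ← inv_pow]
    nlinarith [sq_nonneg (‖w₁ + (t : ℂ)‖⁻¹ - ‖w₂ + (t : ℂ)‖⁻¹),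
      sq_nonneg ‖w₁ + (t : ℂ)‖⁻¹, sq_nonneg ‖w₂ + (t : ℂ)‖⁻¹]

lemma re_two_pi_I_mul_neg {w : ℂ} (hw : 0 < w.im) : (2 * Real.pi * Complex.I * w).re < 0 := by
  simpa using mul_pos Real.two_pi_pos hw

lemma re_two_pi_I_mul_pos {w : ℂ} (hw : w.im < 0) : 0 < (2 * Real.pi * Complex.I * w).re := by
  simpa using mul_neg_of_pos_of_neg Real.two_pi_pos hw

lemma integrableOn_id_mul_exp_mul_complex_Ioi {a : ℂ} (ha : a.re < 0) :
    IntegrableOn (fun s : ℝ => (s : ℂ) * Complex.exp (a * s)) (Set.Ioi 0) := by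
  have h := integrableOn_rpow_mul_exp_neg_mul_rpow (s := 1) (p := 1) (b := -a.re)
    (by norm_num) one_pos (by linarith)
  refine Integrable.mono' h (by fun_prop) ?_
  filter_upwards [ae_restrict_mem measurableSet_Ioi] with s hs
  rw [norm_mul, Complex.norm_exp, Complex.norm_real, Real.norm_of_nonneg (le_of_lt hs)]
  simp

lemma integral_id_mul_exp_mul_complex_Ioi {a : ℂ} (ha : a.re < 0) :
    ∫ s in Set.Ioi (0 : ℝ), (s : ℂ) * Complex.exp (a * s) = 1 / a ^ 2 := by
  have ha0 : a ≠ 0 := by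
    rintro rfl
    simp at ha
  have hd : ∀ s ∈ Set.Ici (0 : ℝ), HasDerivAt
      (fun s : ℝ => 1 / a * ((s : ℂ) * Complex.exp (a * s)) - 1 / a ^ 2 * Complex.exp (a * s))
      ((s : ℂ) * Complex.exp (a * s)) s := fun s _ => by
    have hs : HasDerivAt (fun s : ℝ => (s : ℂ)) 1 s := Complex.ofRealCLM.hasDerivAt
    have he := (hs.const_mul a).cexp
    refine (((hs.mul he).const_mul (1 / a)).sub (he.const_mul (1 / a ^ 2))).congr_deriv ?_
    field_simp
    ring
  have hlim : ∀ k : ℕ, Filter.Tendsto (fun s : ℝ => (s : ℂ) ^ k * Complex.exp (a * s))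
      Filter.atTop (nhds 0) := fun k => by
    rw [tendsto_zero_iff_norm_tendsto_zero]
    refine (tendsto_rpow_mul_exp_neg_mul_atTop_nhds_zero k (-a.re) (by linarith)).congr' ?_
    filter_upwards [Filter.eventually_ge_atTop 0] with s hs
    rw [norm_mul, norm_pow, Complex.norm_exp, Complex.norm_real, Real.norm_of_nonneg hs]
    simp
  have ht := ((hlim 1).const_mul (1 / a)).sub ((hlim 0).const_mul (1 / a ^ 2))
  simp only [pow_one, pow_zero, one_mul, mul_zero, sub_zero] at ht
  rw [integral_Ioi_of_hasDerivAt_of_tendsto' hd (integrableOn_id_mul_exp_mul_complex_Ioi ha) ht]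
  simp

lemma exp_mul_exp_two_pi_I (w : ℂ) (t s : ℝ) :
    Complex.exp (2 * Real.pi * Complex.I * t * s) * Complex.exp (2 * Real.pi * Complex.I * w * s) =
      Complex.exp (2 * Real.pi * Complex.I * (w + t) * s) := by
  rw [← Complex.exp_add]
  congr 1
  ring

lemma fourier_inv_mul_of_im_pos_of_ne {w₁ w₂ : ℂ} (h₁ : 0 < w₁.im) (h₂ : 0 < w₂.im)
    (hne : w₁ ≠ w₂) (x : ℝ) :
    ∫ t : ℝ, Complex.exp (-(2 * Real.pi * Complex.I * x * t)) * ((w₁ + t) * (w₂ + t))⁻¹ =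
      if x ≤ 0 then 0 else 2 * Real.pi * Complex.I / (w₂ - w₁) *
        (Complex.exp (2 * Real.pi * Complex.I * w₂ * x) -
          Complex.exp (2 * Real.pi * Complex.I * w₁ * x)) := by
  refine fourier_integral_eq_of_halves (f := fun _ => 0)
    (g := fun s : ℝ => 2 * Real.pi * Complex.I / (w₂ - w₁) *
        (Complex.exp (2 * Real.pi * Complex.I * w₂ * s) -
          Complex.exp (2 * Real.pi * Complex.I * w₁ * s)))
    continuous_const (by fun_prop) (by simp) integrableOn_zero
    (((integrableOn_exp_mul_complex_Ioi (re_two_pi_I_mul_neg h₂) 0).sub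
      (integrableOn_exp_mul_complex_Ioi (re_two_pi_I_mul_neg h₁) 0)).const_mul _)
    (integrable_inv_mul_add_ofReal h₁.ne' h₂.ne') (fun t => ?_) x
  have h₁' : (2 * Real.pi * Complex.I * (w₁ + t)).re < 0 := re_two_pi_I_mul_neg (by simpa)
  have h₂' : (2 * Real.pi * Complex.I * (w₂ + t)).re < 0 := re_two_pi_I_mul_neg (by simpa)
  have e : ∀ s : ℝ, Complex.exp (2 * Real.pi * Complex.I * t * s) *
      (2 * Real.pi * Complex.I / (w₂ - w₁) * (Complex.exp (2 * Real.pi * Complex.I * w₂ * s) -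
          Complex.exp (2 * Real.pi * Complex.I * w₁ * s))) =
      2 * Real.pi * Complex.I / (w₂ - w₁) *
        (Complex.exp (2 * Real.pi * Complex.I * (w₂ + t) * s) -
          Complex.exp (2 * Real.pi * Complex.I * (w₁ + t) * s)) := fun s => by
    rw [← exp_mul_exp_two_pi_I, ← exp_mul_exp_two_pi_I]
    ring
  simp_rw [e, mul_zero]
  rw [integral_zero, zero_add, integral_const_mul, integral_sub
    (integrableOn_exp_mul_complex_Ioi h₂' 0) (integrableOn_exp_mul_complex_Ioi h₁' 0),
    integral_exp_mul_complex_Ioi h₁', integral_exp_mul_complex_Ioi h₂']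
  have a₁ := add_ofReal_ne_zero_of_im_ne_zero h₁.ne' t
  have a₂ := add_ofReal_ne_zero_of_im_ne_zero h₂.ne' t
  have a₃ := sub_ne_zero.2 hne.symm
  have := Complex.I_ne_zero
  have : (Real.pi : ℂ) ≠ 0 := by exact_mod_cast Real.pi_ne_zero
  simp only [Complex.ofReal_zero, mul_zero, Complex.exp_zero]
  field_simp
  ring

lemma fourier_inv_mul_self_of_im_pos {w : ℂ} (hw : 0 < w.im) (x : ℝ) :
    ∫ t : ℝ, Complex.exp (-(2 * Real.pi * Complex.I * x * t)) * ((w + t) * (w + t))⁻¹ =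
      if x ≤ 0 then 0 else -(4 * (Real.pi : ℂ) ^ 2) *
        (x * Complex.exp (2 * Real.pi * Complex.I * w * x)) := by
  refine fourier_integral_eq_of_halves (f := fun _ => 0)
    (g := fun s : ℝ => -(4 * (Real.pi : ℂ) ^ 2) *
        (s * Complex.exp (2 * Real.pi * Complex.I * w * s)))
    continuous_const (by fun_prop) (by simp) integrableOn_zero
    ((integrableOn_id_mul_exp_mul_complex_Ioi (re_two_pi_I_mul_neg hw)).const_mul _)
    (integrable_inv_mul_add_ofReal hw.ne' hw.ne') (fun t => ?_) x
  have e : ∀ s : ℝ, Complex.exp (2 * Real.pi * Complex.I * t * s) *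
      (-(4 * (Real.pi : ℂ) ^ 2) * (s * Complex.exp (2 * Real.pi * Complex.I * w * s))) =
      -(4 * (Real.pi : ℂ) ^ 2) *
        (s * Complex.exp (2 * Real.pi * Complex.I * (w + t) * s)) := fun s => by
    rw [← exp_mul_exp_two_pi_I]
    ring
  simp_rw [e, mul_zero]
  rw [integral_zero, zero_add, integral_const_mul,
    integral_id_mul_exp_mul_complex_Ioi (re_two_pi_I_mul_neg (by simpa))]
  have a₁ := add_ofReal_ne_zero_of_im_ne_zero hw.ne' t
  have : (Real.pi : ℂ) ≠ 0 := by exact_mod_cast Real.pi_ne_zero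
  rw [mul_pow, mul_pow, mul_pow, Complex.I_sq]
  field_simp
  ring

lemma fourier_inv_mul_of_im_neg_of_im_pos {w₁ w₂ : ℂ} (h₁ : w₁.im < 0) (h₂ : 0 < w₂.im)
    (x : ℝ) :
    ∫ t : ℝ, Complex.exp (-(2 * Real.pi * Complex.I * x * t)) * ((w₁ + t) * (w₂ + t))⁻¹ =
      if x ≤ 0 then
        2 * Real.pi * Complex.I / (w₂ - w₁) * Complex.exp (2 * Real.pi * Complex.I * w₁ * x)
      else
        2 * Real.pi * Complex.I / (w₂ - w₁) * Complex.exp (2 * Real.pi * Complex.I * w₂ * x) := by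
  refine fourier_integral_eq_of_halves
    (f := fun s : ℝ => 2 * Real.pi * Complex.I / (w₂ - w₁) *
        Complex.exp (2 * Real.pi * Complex.I * w₁ * s))
    (g := fun s : ℝ => 2 * Real.pi * Complex.I / (w₂ - w₁) *
        Complex.exp (2 * Real.pi * Complex.I * w₂ * s))
    (by fun_prop) (by fun_prop) (by simp)
    ((integrableOn_exp_mul_complex_Iic (re_two_pi_I_mul_pos h₁) 0).const_mul _)
    ((integrableOn_exp_mul_complex_Ioi (re_two_pi_I_mul_neg h₂) 0).const_mul _)
    (integrable_inv_mul_add_ofReal h₁.ne h₂.ne') (fun t => ?_) x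
  have e : ∀ (w : ℂ) (s : ℝ), Complex.exp (2 * Real.pi * Complex.I * t * s) *
      (2 * Real.pi * Complex.I / (w₂ - w₁) * Complex.exp (2 * Real.pi * Complex.I * w * s)) =
      2 * Real.pi * Complex.I / (w₂ - w₁) *
        Complex.exp (2 * Real.pi * Complex.I * (w + t) * s) := fun w s => by
    rw [← exp_mul_exp_two_pi_I]
    ring
  simp_rw [e]
  rw [integral_const_mul, integral_const_mul,
    integral_exp_mul_complex_Iic (re_two_pi_I_mul_pos (by simpa)),
    integral_exp_mul_complex_Ioi (re_two_pi_I_mul_neg (by simpa))]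
  have a₁ := add_ofReal_ne_zero_of_im_ne_zero h₁.ne t
  have a₂ := add_ofReal_ne_zero_of_im_ne_zero h₂.ne' t
  have a₃ : w₂ - w₁ ≠ 0 := by
    intro h
    have := congrArg Complex.im h
    simp only [Complex.sub_im, Complex.zero_im] at this
    linarith
  have := Complex.I_ne_zero
  have : (Real.pi : ℂ) ≠ 0 := by exact_mod_cast Real.pi_ne_zero
  simp only [Complex.ofReal_zero, mul_zero, Complex.exp_zero]
  field_simp
  ring

theorem stmt12 (n : ℤ) (w₁ w₂ : ℂ) (h₁ : w₁.im ≠ 0) (h₂ : 0 < w₂.im) :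
    Integrable (fun t : ℝ =>
        Complex.exp (-(2 * (Real.pi : ℂ) * Complex.I * (n : ℂ) * (t : ℂ))) /
          ((w₁ + (t : ℂ)) * (w₂ + (t : ℂ)))) ∧
    (n ≤ 0 → 0 < w₁.im →
      (∫ t : ℝ, Complex.exp (-(2 * (Real.pi : ℂ) * Complex.I * (n : ℂ) * (t : ℂ))) /
          ((w₁ + (t : ℂ)) * (w₂ + (t : ℂ)))) = 0) ∧
    (n ≤ 0 → w₁.im < 0 →
      (∫ t : ℝ, Complex.exp (-(2 * (Real.pi : ℂ) * Complex.I * (n : ℂ) * (t : ℂ))) /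
          ((w₁ + (t : ℂ)) * (w₂ + (t : ℂ)))) =
        2 * (Real.pi : ℂ) * Complex.I / (w₂ - w₁) *
          Complex.exp (2 * (Real.pi : ℂ) * Complex.I * (n : ℂ) * w₁)) ∧
    (0 < n → w₁.im < 0 →
      (∫ t : ℝ, Complex.exp (-(2 * (Real.pi : ℂ) * Complex.I * (n : ℂ) * (t : ℂ))) /
          ((w₁ + (t : ℂ)) * (w₂ + (t : ℂ)))) =
        2 * (Real.pi : ℂ) * Complex.I / (w₂ - w₁) *
          Complex.exp (2 * (Real.pi : ℂ) * Complex.I * (n : ℂ) * w₂)) ∧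
    (0 < n → 0 < w₁.im → w₁ ≠ w₂ →
      (∫ t : ℝ, Complex.exp (-(2 * (Real.pi : ℂ) * Complex.I * (n : ℂ) * (t : ℂ))) /
          ((w₁ + (t : ℂ)) * (w₂ + (t : ℂ)))) =
        2 * (Real.pi : ℂ) * Complex.I / (w₂ - w₁) *
          (Complex.exp (2 * (Real.pi : ℂ) * Complex.I * (n : ℂ) * w₂) -
            Complex.exp (2 * (Real.pi : ℂ) * Complex.I * (n : ℂ) * w₁))) ∧
    (0 < n → w₁ = w₂ →
      (∫ t : ℝ, Complex.exp (-(2 * (Real.pi : ℂ) * Complex.I * (n : ℂ) * (t : ℂ))) /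
          ((w₁ + (t : ℂ)) * (w₂ + (t : ℂ)))) =
        -(4 * (Real.pi : ℂ) ^ 2 * (n : ℂ)) *
          Complex.exp (2 * (Real.pi : ℂ) * Complex.I * (n : ℂ) * w₁)) := by
  simp_rw [div_eq_mul_inv (Complex.exp _)]
  have cast : ((n : ℝ) : ℂ) = n := Complex.ofReal_intCast n
  have comm : ∀ w : ℂ, 2 * (Real.pi : ℂ) * Complex.I * (n : ℂ) * w =
      2 * (Real.pi : ℂ) * Complex.I * w * (n : ℂ) := fun w => mul_right_comm _ _ _
  have hle : n ≤ 0 → (n : ℝ) ≤ 0 := fun h => by exact_mod_cast h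
  have hnle : 0 < n → ¬ (n : ℝ) ≤ 0 := fun h => by exact_mod_cast h.not_ge
  refine ⟨?_, fun hn hw => ?_, fun hn hw => ?_, fun hn hw => ?_, fun hn hw hne => ?_,
    fun hn heq => ?_⟩
  · refine (integrable_inv_mul_add_ofReal h₁ h₂.ne').bdd_mul (c := 1) (by fun_prop)
      (Filter.Eventually.of_forall fun t => ?_)
    rw [show -(2 * (Real.pi : ℂ) * Complex.I * n * t) =
      ((-(2 * Real.pi * n * t) : ℝ) : ℂ) * Complex.I by push_cast; ring,
      Complex.norm_exp_ofReal_mul_I]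
  · rcases eq_or_ne w₁ w₂ with rfl | hne
    · have := fourier_inv_mul_self_of_im_pos hw n
      rwa [if_pos (hle hn), cast] at this
    · have := fourier_inv_mul_of_im_pos_of_ne hw h₂ hne n
      rwa [if_pos (hle hn), cast] at this
  · have := fourier_inv_mul_of_im_neg_of_im_pos hw h₂ n
    rwa [if_pos (hle hn), cast, ← comm] at this
  · have := fourier_inv_mul_of_im_neg_of_im_pos hw h₂ n
    rwa [if_neg (hnle hn), cast, ← comm] at this
  · have := fourier_inv_mul_of_im_pos_of_ne hw h₂ hne n
    rwa [if_neg (hnle hn), cast, ← comm, ← comm] at this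
  · subst heq
    have := fourier_inv_mul_self_of_im_pos h₂ n
    rw [if_neg (hnle hn), cast, ← comm] at this
    rw [this]
    ring
end

section
/- Let z = x + iy with x ∈ ℝ and y > 0, and let t₀ > 0. Then for every s ∈ ℂ the integral F(s) := ∫_{t₀}^∞ t^{s−1} / (e^{2π(t + i z̄)} − 1) dt converges and equals Σ_{n≥1} e^{−2πin z̄} Γ(s, 2πn t₀)/(2πn)^s (the series converging absolutely and locally uniformly in s); the function s ↦ F(s) is entire; and for each fixed s and t₀, F(s) → 0 as y → ∞. -/
open MeasureTheory

/-- The upper incomplete Gamma function `Γ(s,a) = ∫_a^∞ t^{s-1} e^{-t} dt`. -/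
noncomputable def IncGamma (s : ℂ) (a : ℝ) : ℂ :=
  ∫ t in Set.Ioi a, (t : ℂ) ^ (s - 1) * (Real.exp (-t) : ℂ)

/-- `F(s) = ∫_{t₀}^∞ t^{s-1}/(e^{2π(t + i z̄)} - 1) dt` where `z = x + iy`,
so `z̄ = x - iy` and `t + i z̄ = (t + y) + i x`. -/
noncomputable def Fint (x y t₀ : ℝ) (s : ℂ) : ℂ :=
  ∫ t in Set.Ioi t₀,
    (t : ℂ) ^ (s - 1) /
      (Complex.exp (2 * (Real.pi : ℂ) * ((t : ℂ) + Complex.I * ((x : ℂ) - (y : ℂ) * Complex.I))) - 1)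

/-- The Mellin transform of a function that decays exponentially, truncated away from `0`. -/
theorem mellin_indicator_Ioi_of_norm_le_exp {f : ℝ → ℂ} {a b C : ℝ} (ha : 0 < a)
    (hb : 0 < b) (hf : ContinuousOn f (Set.Ioi a))
    (hC : ∀ t ∈ Set.Ioi a, ‖f t‖ ≤ C * Real.exp (-b * t)) (s : ℂ) :
    MellinConvergent ((Set.Ioi a).indicator f) s ∧
      DifferentiableAt ℂ (mellin ((Set.Ioi a).indicator f)) s := by
  have hint : IntegrableOn f (Set.Ioi a) :=
    ((exp_neg_integrableOn_Ioi a hb).const_mul C).mono'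
      (hf.aestronglyMeasurable measurableSet_Ioi)
      ((ae_restrict_iff' measurableSet_Ioi).2 (.of_forall hC))
  have hloc : LocallyIntegrableOn ((Set.Ioi a).indicator f) (Set.Ioi 0) :=
    (hint.integrable_indicator measurableSet_Ioi).locallyIntegrable.locallyIntegrableOn _
  have htop : (Set.Ioi a).indicator f =O[Filter.atTop] fun t => Real.exp (-b * t) := by
    refine .of_bound C ?_
    filter_upwards [Filter.eventually_gt_atTop a] with t ht
    rw [Set.indicator_of_mem (Set.mem_Ioi.2 ht), Real.norm_of_nonneg (Real.exp_pos _).le]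
    exact hC t ht
  have hbot : (Set.Ioi a).indicator f =O[nhdsWithin 0 (Set.Ioi 0)]
      fun t : ℝ => t ^ (-(s.re - 1)) := by
    refine .of_bound 0 ?_
    filter_upwards [nhdsWithin_le_nhds (Iio_mem_nhds ha)] with t ht
    rw [Set.indicator_of_notMem (by simpa using le_of_lt ht)]
    simp
  exact ⟨mellinConvergent_of_isBigO_rpow_exp hb hloc htop hbot (by linarith),
    mellin_differentiableAt_of_isBigO_rpow_exp hb hloc htop hbot (by linarith)⟩

theorem cpow_smul_indicator_Ioi (f : ℝ → ℂ) (a : ℝ) (s : ℂ) :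
    (fun t : ℝ => (t : ℂ) ^ (s - 1) • (Set.Ioi a).indicator f t) =
      (Set.Ioi a).indicator fun t : ℝ => (t : ℂ) ^ (s - 1) * f t := by
  ext t
  by_cases ht : t ∈ Set.Ioi a <;> simp [ht]

theorem integrableOn_cpow_mul_of_norm_le_exp {f : ℝ → ℂ} {a b C : ℝ} (ha : 0 < a)
    (hb : 0 < b) (hf : ContinuousOn f (Set.Ioi a))
    (hC : ∀ t ∈ Set.Ioi a, ‖f t‖ ≤ C * Real.exp (-b * t)) (s : ℂ) :
    IntegrableOn (fun t : ℝ => (t : ℂ) ^ (s - 1) * f t) (Set.Ioi a) := by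
  have h := (mellin_indicator_Ioi_of_norm_le_exp ha hb hf hC s).1
  rw [MellinConvergent, cpow_smul_indicator_Ioi] at h
  refine (h.mono_set (Set.Ioi_subset_Ioi ha.le)).congr_fun (fun t ht => ?_) measurableSet_Ioi
  exact Set.indicator_of_mem ht _

theorem differentiable_integral_cpow_mul_of_norm_le_exp {f : ℝ → ℂ} {a b C : ℝ}
    (ha : 0 < a) (hb : 0 < b) (hf : ContinuousOn f (Set.Ioi a))
    (hC : ∀ t ∈ Set.Ioi a, ‖f t‖ ≤ C * Real.exp (-b * t)) :
    Differentiable ℂ fun s : ℂ => ∫ t in Set.Ioi a, (t : ℂ) ^ (s - 1) * f t := by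
  intro s
  have h := (mellin_indicator_Ioi_of_norm_le_exp ha hb hf hC s).2
  convert h using 2 with s
  rw [mellin, cpow_smul_indicator_Ioi, setIntegral_indicator measurableSet_Ioi,
    Set.inter_eq_self_of_subset_right (Set.Ioi_subset_Ioi ha.le)]

theorem integral_cpow_mul_exp_neg_mul_Ioi_eq_IncGamma {a b : ℝ} (ha : 0 < a) (hb : 0 < b)
    (s : ℂ) :
    ∫ t in Set.Ioi a, (t : ℂ) ^ (s - 1) * (Real.exp (-b * t) : ℂ) =
      IncGamma s (b * a) / (b : ℂ) ^ s := by
  have hb' : (b : ℂ) ≠ 0 := mod_cast hb.ne'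
  have hbs : (b : ℂ) ^ s ≠ 0 := by simp [Complex.cpow_eq_zero_iff, hb']
  rw [eq_div_iff hbs, IncGamma, ← integral_comp_mul_left_Ioi' _ a hb, mul_comm,
    ← integral_const_mul, ← integral_smul]
  refine setIntegral_congr_fun measurableSet_Ioi fun t ht => ?_
  have ht : 0 < t := ha.trans ht
  have hs : (b : ℂ) ^ s = b * (b : ℂ) ^ (s - 1) := by
    rw [Complex.cpow_sub _ _ hb', Complex.cpow_one]
    field_simp
  simp only [Complex.real_smul, Complex.ofReal_mul, Complex.mul_cpow_ofReal_nonneg hb.le ht.le, hs,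
    neg_mul]
  ring

theorem norm_exp_two_pi_mul (t : ℝ) (w : ℂ) :
    ‖Complex.exp (2 * (Real.pi : ℂ) * (t + w))‖ =
      Real.exp (2 * Real.pi * t) * Real.exp (2 * Real.pi * w.re) := by
  rw [Complex.norm_exp, ← Real.exp_add]
  congr 1
  simp [Complex.mul_re]
  ring

theorem one_lt_exp_two_pi_mul {u : ℝ} (hu : 0 < u) : 1 < Real.exp (2 * Real.pi * u) :=
  Real.one_lt_exp_iff.2 (by positivity)

theorem one_lt_norm_exp_two_pi_mul {t : ℝ} (ht : 0 < t) {w : ℂ} (hw : 0 < w.re) :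
    1 < ‖Complex.exp (2 * (Real.pi : ℂ) * (t + w))‖ := by
  rw [norm_exp_two_pi_mul]
  exact one_lt_mul_of_lt_of_le (one_lt_exp_two_pi_mul ht) (one_lt_exp_two_pi_mul hw).le

theorem exp_two_pi_mul_sub_one_ne_zero {t : ℝ} (ht : 0 < t) {w : ℂ} (hw : 0 < w.re) :
    Complex.exp (2 * (Real.pi : ℂ) * (t + w)) - 1 ≠ 0 := by
  intro h
  have := one_lt_norm_exp_two_pi_mul ht hw
  rw [sub_eq_zero.1 h] at this
  simp at this

theorem norm_inv_exp_two_pi_mul_sub_one_le {t : ℝ} (ht : 0 < t) {w : ℂ} (hw : 0 < w.re) :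
    ‖(Complex.exp (2 * (Real.pi : ℂ) * (t + w)) - 1)⁻¹‖ ≤
      (Real.exp (2 * Real.pi * w.re) - 1)⁻¹ * Real.exp (-(2 * Real.pi) * t) := by
  have h1 := one_lt_exp_two_pi_mul ht
  have h2 := one_lt_exp_two_pi_mul hw
  rw [norm_inv, neg_mul, Real.exp_neg, ← mul_inv]
  refine inv_anti₀ (mul_pos (by linarith) (Real.exp_pos _)) ?_
  have h3 := norm_sub_norm_le (Complex.exp (2 * (Real.pi : ℂ) * (t + w))) 1
  rw [norm_exp_two_pi_mul, norm_one] at h3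
  nlinarith

theorem continuousOn_inv_exp_two_pi_mul_sub_one {a : ℝ} (ha : 0 < a) {w : ℂ}
    (hw : 0 < w.re) :
    ContinuousOn (fun t : ℝ => (Complex.exp (2 * (Real.pi : ℂ) * (t + w)) - 1)⁻¹) (Set.Ioi a) :=
  ContinuousOn.inv₀ (by fun_prop) fun _ ht => exp_two_pi_mul_sub_one_ne_zero (ha.trans ht) hw

theorem hasSum_inv_exp_two_pi_mul_sub_one {t : ℝ} (ht : 0 < t) {w : ℂ} (hw : 0 < w.re) :
    HasSum (fun n : ℕ => Complex.exp (-(2 * (Real.pi : ℂ) * ((n : ℂ) + 1) * w)) *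
        (Real.exp (-(2 * Real.pi * ((n : ℝ) + 1)) * t) : ℂ))
      (Complex.exp (2 * (Real.pi : ℂ) * (t + w)) - 1)⁻¹ := by
  have hE := one_lt_norm_exp_two_pi_mul ht hw
  set E := Complex.exp (2 * (Real.pi : ℂ) * (t + w)) with hEdef
  have hE0 : E ≠ 0 := Complex.exp_ne_zero _
  have h := (hasSum_geometric_of_norm_lt_one
    (show ‖E⁻¹‖ < 1 by rw [norm_inv]; exact inv_lt_one_of_one_lt₀ hE)).mul_left E⁻¹
  rw [← mul_inv, mul_sub, mul_one, mul_inv_cancel₀ hE0] at h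
  refine (congrArg (HasSum · _) (funext fun n => ?_)).mpr h
  rw [← pow_succ', hEdef, ← Complex.exp_neg, ← Complex.exp_nat_mul, Complex.ofReal_exp,
    ← Complex.exp_add]
  push_cast
  ring_nf

theorem norm_exp_neg_two_pi_mul_mul_exp_le {t : ℝ} (ht : 0 < t) {w : ℂ} (hw : 0 < w.re)
    (n : ℕ) :
    ‖Complex.exp (-(2 * (Real.pi : ℂ) * ((n : ℂ) + 1) * w)) *
        (Real.exp (-(2 * Real.pi * ((n : ℝ) + 1)) * t) : ℂ)‖ ≤
      Real.exp (-(2 * Real.pi * w.re)) ^ n * Real.exp (-(2 * Real.pi) * t) := by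
  have hre : (-(2 * (Real.pi : ℂ) * ((n : ℂ) + 1) * w)).re =
      -(2 * Real.pi * ((n : ℝ) + 1) * w.re) := by
    have : -(2 * (Real.pi : ℂ) * ((n : ℂ) + 1) * w) =
        ((-(2 * Real.pi * ((n : ℝ) + 1)) : ℝ) : ℂ) * w := by
      push_cast
      ring
    rw [this, Complex.re_ofReal_mul]
    ring
  rw [norm_mul, Complex.norm_exp, hre, Complex.norm_real, Real.norm_of_nonneg (Real.exp_pos _).le,
    ← Real.exp_add, ← Real.exp_nat_mul, ← Real.exp_add, Real.exp_le_exp]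
  have h1 : 0 < Real.pi * w.re := mul_pos Real.pi_pos hw
  have h2 : 0 ≤ (n : ℝ) * (Real.pi * t) := by positivity
  nlinarith

theorem summable_norm_and_integral_eq_tsum_IncGamma {a : ℝ} (ha : 0 < a) {w : ℂ}
    (hw : 0 < w.re) (s : ℂ) :
    Summable (fun n : ℕ => ‖Complex.exp (-(2 * (Real.pi : ℂ) * ((n : ℂ) + 1) * w)) *
        IncGamma s (2 * Real.pi * ((n : ℝ) + 1) * a) /
          ((2 * Real.pi * ((n : ℝ) + 1) : ℝ) : ℂ) ^ s‖) ∧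
      ∫ t in Set.Ioi a, (t : ℂ) ^ (s - 1) * (Complex.exp (2 * (Real.pi : ℂ) * (t + w)) - 1)⁻¹ =
        ∑' n : ℕ, Complex.exp (-(2 * (Real.pi : ℂ) * ((n : ℂ) + 1) * w)) *
          IncGamma s (2 * Real.pi * ((n : ℝ) + 1) * a) /
            ((2 * Real.pi * ((n : ℝ) + 1) : ℝ) : ℂ) ^ s := by
  have hpi : 0 < 2 * Real.pi := Real.two_pi_pos
  set f : ℕ → ℝ → ℂ := fun n t =>
    Complex.exp (-(2 * (Real.pi : ℂ) * ((n : ℂ) + 1) * w)) *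
      (Real.exp (-(2 * Real.pi * ((n : ℝ) + 1)) * t) : ℂ) with hf
  have hbound (n : ℕ) (t : ℝ) (ht : t ∈ Set.Ioi a) : ‖f n t‖ ≤
      Real.exp (-(2 * Real.pi * w.re)) ^ n * Real.exp (-(2 * Real.pi) * t) :=
    norm_exp_neg_two_pi_mul_mul_exp_le (ha.trans ht) hw n
  have hint (n : ℕ) : IntegrableOn (fun t : ℝ => (t : ℂ) ^ (s - 1) * f n t) (Set.Ioi a) :=
    integrableOn_cpow_mul_of_norm_le_exp ha hpi (by fun_prop) (hbound n) s
  have hdom : IntegrableOn (fun t : ℝ => (t : ℂ) ^ (s - 1) *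
      (Real.exp (-(2 * Real.pi) * t) : ℂ)) (Set.Ioi a) :=
    integrableOn_cpow_mul_of_norm_le_exp (C := 1) ha hpi (by fun_prop)
      (fun t _ => by rw [Complex.norm_real, Real.norm_of_nonneg (Real.exp_pos _).le, one_mul]) s
  have hsum : Summable fun n : ℕ => ∫ t in Set.Ioi a, ‖(t : ℂ) ^ (s - 1) * f n t‖ := by
    have hgeom : Summable fun n : ℕ => Real.exp (-(2 * Real.pi * w.re)) ^ n :=
      summable_geometric_of_lt_one (Real.exp_pos _).le
        (Real.exp_lt_one_iff.2 (neg_lt_zero.2 (by positivity)))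
    refine .of_nonneg_of_le (fun n => integral_nonneg fun t => norm_nonneg _) (fun n => ?_)
      (hgeom.mul_right (∫ t in Set.Ioi a, ‖(t : ℂ) ^ (s - 1) *
        (Real.exp (-(2 * Real.pi) * t) : ℂ)‖))
    rw [← integral_const_mul]
    refine setIntegral_mono_on (hint n).norm (hdom.norm.const_mul _) measurableSet_Ioi
      fun t ht => ?_
    calc ‖(t : ℂ) ^ (s - 1) * f n t‖ = ‖(t : ℂ) ^ (s - 1)‖ * ‖f n t‖ := norm_mul _ _
      _ ≤ ‖(t : ℂ) ^ (s - 1)‖ *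
          (Real.exp (-(2 * Real.pi * w.re)) ^ n * Real.exp (-(2 * Real.pi) * t)) :=
        mul_le_mul_of_nonneg_left (hbound n t ht) (norm_nonneg _)
      _ = _ := by
        rw [norm_mul, Complex.norm_real, Real.norm_of_nonneg (Real.exp_pos _).le, mul_left_comm]
  have hterm (n : ℕ) : ∫ t in Set.Ioi a, (t : ℂ) ^ (s - 1) * f n t =
      Complex.exp (-(2 * (Real.pi : ℂ) * ((n : ℂ) + 1) * w)) *
        IncGamma s (2 * Real.pi * ((n : ℝ) + 1) * a) /
          ((2 * Real.pi * ((n : ℝ) + 1) : ℝ) : ℂ) ^ s := by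
    rw [mul_div_assoc, ← integral_cpow_mul_exp_neg_mul_Ioi_eq_IncGamma ha (by positivity) s,
      ← integral_const_mul]
    simp only [hf, mul_left_comm]
  have htot : ∫ t in Set.Ioi a, (t : ℂ) ^ (s - 1) *
      (Complex.exp (2 * (Real.pi : ℂ) * (t + w)) - 1)⁻¹ =
        ∫ t in Set.Ioi a, ∑' n, (t : ℂ) ^ (s - 1) * f n t :=
    setIntegral_congr_fun measurableSet_Ioi fun t ht =>
      ((hasSum_inv_exp_two_pi_mul_sub_one (ha.trans ht) hw).mul_left _).tsum_eq.symm
  simp only [← hterm]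
  exact ⟨.of_nonneg_of_le (fun n => norm_nonneg _) (fun n => norm_integral_le_integral_norm _) hsum,
    htot.trans (hasSum_integral_of_summable_integral_norm hint hsum).tsum_eq.symm⟩

theorem norm_Fint_le {x y t₀ : ℝ} (ht₀ : 0 < t₀) (hy : 0 < y) (s : ℂ) :
    ‖Fint x y t₀ s‖ ≤ (Real.exp (2 * Real.pi * y) - 1)⁻¹ *
      ∫ t in Set.Ioi t₀, ‖(t : ℂ) ^ (s - 1) * (Real.exp (-(2 * Real.pi) * t) : ℂ)‖ := by
  have hre : (Complex.I * ((x : ℂ) - (y : ℂ) * Complex.I)).re = y := by simp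
  rw [Fint, ← integral_const_mul]
  refine norm_integral_le_of_norm_le (Integrable.const_mul (Integrable.norm ?_) _)
    ((ae_restrict_iff' measurableSet_Ioi).2 (.of_forall fun t ht => ?_))
  · exact integrableOn_cpow_mul_of_norm_le_exp (C := 1) ht₀ Real.two_pi_pos (by fun_prop)
      (fun t _ => by rw [Complex.norm_real, Real.norm_of_nonneg (Real.exp_pos _).le, one_mul]) s
  · have h := norm_inv_exp_two_pi_mul_sub_one_le (ht₀.trans ht) (hre.symm ▸ hy)
    rw [hre] at h
    rw [div_eq_mul_inv, norm_mul, norm_mul, Complex.norm_real,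
      Real.norm_of_nonneg (Real.exp_pos _).le, mul_left_comm]
    exact mul_le_mul_of_nonneg_left h (norm_nonneg _)

theorem stmt17 (x t₀ : ℝ) (ht₀ : 0 < t₀) :
    (∀ y : ℝ, 0 < y → ∀ s : ℂ,
      IntegrableOn (fun t : ℝ =>
          (t : ℂ) ^ (s - 1) /
            (Complex.exp (2 * (Real.pi : ℂ) *
              ((t : ℂ) + Complex.I * ((x : ℂ) - (y : ℂ) * Complex.I))) - 1))
        (Set.Ioi t₀) ∧
      Summable (fun n : ℕ =>
        ‖Complex.exp (-(2 * (Real.pi : ℂ) * Complex.I * ((n : ℂ) + 1) *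
            ((x : ℂ) - (y : ℂ) * Complex.I))) *
          IncGamma s (2 * Real.pi * ((n : ℝ) + 1) * t₀) /
            ((2 * Real.pi * ((n : ℝ) + 1) : ℝ) : ℂ) ^ s‖) ∧
      Fint x y t₀ s =
        ∑' n : ℕ,
          Complex.exp (-(2 * (Real.pi : ℂ) * Complex.I * ((n : ℂ) + 1) *
              ((x : ℂ) - (y : ℂ) * Complex.I))) *
            IncGamma s (2 * Real.pi * ((n : ℝ) + 1) * t₀) /
              ((2 * Real.pi * ((n : ℝ) + 1) : ℝ) : ℂ) ^ s) ∧
    (∀ y : ℝ, 0 < y → Differentiable ℂ (fun s : ℂ => Fint x y t₀ s)) ∧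
    (∀ s : ℂ, Filter.Tendsto (fun y : ℝ => Fint x y t₀ s) Filter.atTop (nhds 0)) := by
  have hre (y : ℝ) : (Complex.I * ((x : ℂ) - (y : ℂ) * Complex.I)).re = y := by simp
  have hw {y : ℝ} (hy : 0 < y) : 0 < (Complex.I * ((x : ℂ) - (y : ℂ) * Complex.I)).re :=
    (hre y).symm ▸ hy
  have hcont {y : ℝ} (hy : 0 < y) := continuousOn_inv_exp_two_pi_mul_sub_one ht₀ (hw hy)
  have hbound {y : ℝ} (hy : 0 < y) (t : ℝ) (ht : t ∈ Set.Ioi t₀) :=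
    norm_inv_exp_two_pi_mul_sub_one_le (ht₀.trans ht) (hw hy)
  refine ⟨fun y hy s => ⟨?_, ?_⟩, fun y hy => ?_, fun s => ?_⟩
  · simp only [div_eq_mul_inv]
    exact integrableOn_cpow_mul_of_norm_le_exp ht₀ Real.two_pi_pos (hcont hy) (hbound hy) s
  · have h := summable_norm_and_integral_eq_tsum_IncGamma ht₀ (hw hy) s
    have hexp (n : ℕ) : 2 * (Real.pi : ℂ) * Complex.I * ((n : ℂ) + 1) *
        ((x : ℂ) - (y : ℂ) * Complex.I) =
          2 * (Real.pi : ℂ) * ((n : ℂ) + 1) *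
            (Complex.I * ((x : ℂ) - (y : ℂ) * Complex.I)) := by ring
    simp only [hexp, Fint]
    refine ⟨h.1, Eq.trans ?_ h.2⟩
    simp only [div_eq_mul_inv]
  · simp only [Fint, div_eq_mul_inv]
    exact differentiable_integral_cpow_mul_of_norm_le_exp ht₀ Real.two_pi_pos (hcont hy) (hbound hy)
  · have hlim : Filter.Tendsto (fun y : ℝ => (Real.exp (2 * Real.pi * y) - 1)⁻¹ *
        ∫ t in Set.Ioi t₀, ‖(t : ℂ) ^ (s - 1) * (Real.exp (-(2 * Real.pi) * t) : ℂ)‖)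
        Filter.atTop (nhds 0) := by
      rw [← zero_mul (∫ t in Set.Ioi t₀, ‖(t : ℂ) ^ (s - 1) *
        (Real.exp (-(2 * Real.pi) * t) : ℂ)‖)]
      refine (Filter.Tendsto.inv_tendsto_atTop ?_).mul_const _
      exact Filter.tendsto_atTop_add_const_right _ _ (Real.tendsto_exp_atTop.comp
        (Filter.tendsto_id.const_mul_atTop Real.two_pi_pos))
    refine squeeze_zero_norm' ?_ hlim
    filter_upwards [Filter.eventually_gt_atTop 0] with y hy
    exact norm_Fint_le ht₀ hy s
end
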